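/- Let (x,y,z) be a generic triple of octonions, i.e. x = x₁ + x₂ i, y = y₁ + y₂ i + y₃ j, z = z₁ + z₂ i + z₃ j + z₄ k + z₈ ℓ with real coefficients, and suppose the associator [x,y,z] = 2 x₂ y₃ z₈ (kℓ) is nonzero (equivalently x₂ y₃ z₈ ≠ 0). Set v = (x,y,z)ᵀ and λ = [x,y,z]. If A = !![p, a, conj c; conj a, m, b; c, conj b, n] is a Jordan matrix satisfying A v = v λ, then b is orthogonal to λ, i.e. the coefficient b₅ of kℓ in the expansion b = b₁ + b₂ i + b₃ j + b₄ k + b₅ kℓ + b₆ jℓ + b₇ iℓ + b₈ ℓ vanishes: b₅ = 0. -/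

import Mathlib

noncomputable section

/-- The octonions, as the Cayley–Dickson double of the quaternions. -/
def Octonion : Type := Quaternion ℝ × Quaternion ℝ

namespace Octonion

instance : AddCommGroup Octonion :=
  inferInstanceAs (AddCommGroup (Quaternion ℝ × Quaternion ℝ))

instance : Module ℝ Octonion :=
  inferInstanceAs (Module ℝ (Quaternion ℝ × Quaternion ℝ))

/-- Cayley–Dickson multiplication: (a,b)·(c,d) = (a c − conj(d) b, d a + b conj(c)). -/
instance : Mul Octonion :=
  ⟨fun x y => (x.1 * y.1 - star y.2 * x.2, y.2 * x.1 + x.2 * star y.1)⟩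

instance : One Octonion := ⟨((1 : Quaternion ℝ), 0)⟩

/-- Octonionic conjugation: conj (a,b) = (conj a, −b). -/
def conj (x : Octonion) : Octonion := (star x.1, -x.2)

/-- Real part of an octonion. -/
def re (x : Octonion) : ℝ := x.1.re

/-- Imaginary part of an octonion. -/
def im (x : Octonion) : Octonion := x - re x • 1

/-- Embedding of the reals into the octonions. -/
def ofReal (r : ℝ) : Octonion := (((r : ℝ) : Quaternion ℝ), 0)

/-- The squared norm |w|² (the real scalar such that w · conj w = |w|² · 1). -/
def normSq (x : Octonion) : ℝ := Quaternion.normSq x.1 + Quaternion.normSq x.2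

/-- The imaginary unit i. -/
def i : Octonion := ((⟨0, 1, 0, 0⟩ : Quaternion ℝ), 0)

/-- The imaginary unit j. -/
def j : Octonion := ((⟨0, 0, 1, 0⟩ : Quaternion ℝ), 0)

/-- The imaginary unit k. -/
def k : Octonion := ((⟨0, 0, 0, 1⟩ : Quaternion ℝ), 0)

/-- The imaginary unit ℓ. -/
def l : Octonion := ((0 : Quaternion ℝ), (1 : Quaternion ℝ))

/-- The associator [x,y,z] = (xy)z − x(yz). -/
def assoc (x y z : Octonion) : Octonion := x * y * z - x * (y * z)

/-- A Jordan matrix: a 3×3 Hermitian matrix over the octonions. -/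
def IsHermitian (A : Matrix (Fin 3) (Fin 3) Octonion) : Prop :=
  ∀ p q : Fin 3, conj (A q p) = A p q

/-- The right eigenvalue equation `A v = v λ`, componentwise. -/
def Eig (A : Matrix (Fin 3) (Fin 3) Octonion) (v : Fin 3 → Octonion) (lam : Octonion) : Prop :=
  ∀ p : Fin 3, A p 0 * v 0 + A p 1 * v 1 + A p 2 * v 2 = v p * lam

end Octonion

namespace Octonion

/-- The quaternion with given real components. -/
def quat (r s t u : ℝ) : Quaternion ℝ := ⟨r, s, t, u⟩

@[simp] lemma re_quat (r s t u : ℝ) : (quat r s t u).re = r := rfl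

@[simp] lemma imI_quat (r s t u : ℝ) : (quat r s t u).imI = s := rfl

@[simp] lemma imJ_quat (r s t u : ℝ) : (quat r s t u).imJ = t := rfl

@[simp] lemma imK_quat (r s t u : ℝ) : (quat r s t u).imK = u := rfl

lemma fst_add (x y : Octonion) : (x + y).1 = x.1 + y.1 := rfl

lemma snd_add (x y : Octonion) : (x + y).2 = x.2 + y.2 := rfl

lemma fst_sub (x y : Octonion) : (x - y).1 = x.1 - y.1 := rfl

lemma snd_sub (x y : Octonion) : (x - y).2 = x.2 - y.2 := rfl

lemma fst_smul (r : ℝ) (x : Octonion) : (r • x).1 = r • x.1 := rfl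

lemma snd_smul (r : ℝ) (x : Octonion) : (r • x).2 = r • x.2 := rfl

lemma fst_mul (x y : Octonion) : (x * y).1 = x.1 * y.1 - star y.2 * x.2 := rfl

lemma snd_mul (x y : Octonion) : (x * y).2 = y.2 * x.1 + x.2 * star y.1 := rfl

lemma fst_one : (1 : Octonion).1 = 1 := rfl

lemma snd_one : (1 : Octonion).2 = 0 := rfl

lemma fst_conj (x : Octonion) : (conj x).1 = star x.1 := rfl

lemma snd_conj (x : Octonion) : (conj x).2 = -x.2 := rfl

lemma fst_ofReal (r : ℝ) : (ofReal r).1 = (r : Quaternion ℝ) := rfl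

lemma snd_ofReal (r : ℝ) : (ofReal r).2 = 0 := rfl

lemma fst_i : i.1 = quat 0 1 0 0 := rfl

lemma snd_i : i.2 = 0 := rfl

lemma fst_j : j.1 = quat 0 0 1 0 := rfl

lemma snd_j : j.2 = 0 := rfl

lemma fst_k : k.1 = quat 0 0 0 1 := rfl

lemma snd_k : k.2 = 0 := rfl

lemma fst_l : l.1 = 0 := rfl

lemma snd_l : l.2 = 1 := rfl

end Octonion

open scoped Quaternion in
open Octonion in
/-- For a generic triple with nonzero associator, if the Jordan matrix
`!![p, a, conj c; conj a, m, b; c, conj b, n]` admits `v = (x,y,z)ᵀ` as an eigenvector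
with eigenvalue `λ = [x,y,z]`, then the `kℓ`-component of `b` vanishes. -/
theorem b_perp_lambda (x y z : Octonion) (x₁ x₂ y₁ y₂ y₃ z₁ z₂ z₃ z₄ z₈ : ℝ)
    (hx : x = x₁ • 1 + x₂ • i)
    (hy : y = y₁ • 1 + y₂ • i + y₃ • j)
    (hz : z = z₁ • 1 + z₂ • i + z₃ • j + z₄ • k + z₈ • l)
    (hne : x₂ * y₃ * z₈ ≠ 0)
    (p m n : ℝ) (a b c : Octonion) (b₁ b₂ b₃ b₄ b₅ b₆ b₇ b₈ : ℝ)
    (hb : b = b₁ • 1 + b₂ • i + b₃ • j + b₄ • k + b₅ • (k * l) + b₆ • (j * l) +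
      b₇ • (i * l) + b₈ • l)
    (heig : Eig !![ofReal p, a, conj c; conj a, ofReal m, b; c, conj b, ofReal n]
      ![x, y, z] (assoc x y z)) :
    b₅ = 0 := by
  have hyz : y₃ * z₈ ≠ 0 := by
    rw [mul_assoc] at hne
    exact right_ne_zero_of_mul hne
  have h₀ := heig 0
  have h₁ := heig 1
  have h₂ := heig 2
  simp only [Matrix.of_apply, Matrix.cons_val] at h₀ h₁ h₂
  have r₀ := congrArg (fun w : Octonion => w.1.re) h₀
  have i₀ := congrArg (fun w : Octonion => w.1.imI) h₀
  have r₁ := congrArg (fun w : Octonion => w.1.re) h₁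
  have i₁ := congrArg (fun w : Octonion => w.1.imI) h₁
  have k₁ := congrArg (fun w : Octonion => w.1.imK) h₁
  have r₂ := congrArg (fun w : Octonion => w.1.re) h₂
  have i₂ := congrArg (fun w : Octonion => w.1.imI) h₂
  have j₂ := congrArg (fun w : Octonion => w.1.imJ) h₂
  have k₂ := congrArg (fun w : Octonion => w.1.imK) h₂
  have il₂ := congrArg (fun w : Octonion => w.2.imI) h₂
  have hb₅ : b.2.imK = b₅ := by
    simp [hb, snd_add, snd_smul, snd_mul, snd_one, snd_i, snd_j, snd_k, snd_l, fst_i, fst_j,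
      fst_k, fst_l]
  have hx₁ : x.1 = quat x₁ x₂ 0 0 := by
    ext <;> simp [hx, fst_add, fst_smul, fst_one, fst_i]
  have hx₂ : x.2 = 0 := by
    simp [hx, snd_add, snd_smul, snd_one, snd_i]
  have hy₁ : y.1 = quat y₁ y₂ y₃ 0 := by
    ext <;> simp [hy, fst_add, fst_smul, fst_one, fst_i, fst_j]
  have hy₂ : y.2 = 0 := by
    simp [hy, snd_add, snd_smul, snd_one, snd_i, snd_j]
  have hz₁ : z.1 = quat z₁ z₂ z₃ z₄ := by
    ext <;> simp [hz, fst_add, fst_smul, fst_one, fst_i, fst_j, fst_k, fst_l]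
  have hz₂ : z.2 = quat z₈ 0 0 0 := by
    ext <;> simp [hz, snd_add, snd_smul, snd_one, snd_i, snd_j, snd_k, snd_l]
  have hassoc₁ : (assoc x y z).1 = 0 := by
    ext <;> simp [assoc, fst_sub, fst_mul, snd_mul, hx₁, hx₂, hy₁, hy₂, hz₁, hz₂] <;> ring
  have hassoc₂ : (assoc x y z).2 = quat 0 0 0 (2 * x₂ * y₃ * z₈) := by
    ext <;> simp [assoc, snd_sub, fst_mul, snd_mul, hx₁, hx₂, hy₁, hy₂, hz₁, hz₂] <;> ring
  simp only [fst_add, snd_add, fst_mul, snd_mul, fst_conj, snd_conj, fst_ofReal, snd_ofReal,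
    hassoc₁, hassoc₂, hx₁, hx₂, hy₁, hy₂, hz₁, hz₂] at r₀ i₀ r₁ i₁ k₁ r₂ i₂ j₂ k₂ il₂
  simp at r₀ i₀ r₁ i₁ k₁ r₂ i₂ j₂ k₂ il₂
  -- Pair the eigenvalue equation with the vector `v * i`.
  have key : 2 * (y₃ * z₈) * b₅ = 0 := by
    rw [← hb₅]
    linear_combination (-x₂) * r₀ + x₁ * i₀ - y₂ * r₁ + y₁ * i₁ - y₃ * k₁ - z₂ * r₂ + z₁ * i₂ +
      z₄ * j₂ - z₃ * k₂ - z₈ * il₂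
  exact (mul_eq_zero.mp key).resolve_left (mul_ne_zero two_ne_zero hyz)
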